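/- Every eigenvalue λ ∈ k of the operator c_K := K_1 K_2 ⋯ K_d on V_n^{⊗d} is of the form λ = Q^a q^b or λ = −Q^a q^b for some integers a, b. -/

import Mathlib

noncomputable section
namespace QSP

variable {k : Type*} [Field k]

/-- Doubled value of a basis index: `val n j = 2*j - (n-1)`, so that the basis
indices of `V_n` are the integers/half-integers `val/2` in `𝕀_n`. -/
def val (n : ℕ) (j : Fin n) : ℤ := 2 * (j : ℤ) - ((n : ℤ) - 1)

/-- Matrix of the operator `K_Q` on `V_n` in the standard basis. -/
def KQmat (Q : k) (n : ℕ) : Matrix (Fin n) (Fin n) k := fun c b =>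
  if val n b = 0 then (if c = b then Q⁻¹ else 0)
  else (if c = Fin.rev b then 1 else 0) + (if val n b < 0 ∧ c = b then Q⁻¹ - Q else 0)

/-- Matrix of the operator `R_q` on `V_n ⊗ V_n` in the standard basis. -/
def Rmat (q : k) (n : ℕ) : Matrix (Fin n × Fin n) (Fin n × Fin n) k := fun c b =>
  if b.1 = b.2 then (if c = b then q⁻¹ else 0)
  else if b.1 < b.2 then (if c = (b.2, b.1) then 1 else 0)
  else (if c = (b.2, b.1) then 1 else 0) + (if c = b then q⁻¹ - q else 0)

/-- The operators `T_i`, `0 ≤ i ≤ d-1`, on `V_n^{⊗ d}`; `T_0` acts as `K_Q` on the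
first tensor factor, and `T_i` (for `i > 0`) acts as `R_q` on the `(i, i+1)`
tensor factors (1-based). -/
def TB (Q q : k) (n d : ℕ) (i : ℕ) : Module.End k ((Fin d → Fin n) → k) :=
  if _h0 : i = 0 then
    if hd : 0 < d then
      Matrix.toLin' (fun c b =>
        if ∀ j, j ≠ (⟨0, hd⟩ : Fin d) → c j = b j then
          KQmat Q n (c ⟨0, hd⟩) (b ⟨0, hd⟩) else 0)
    else 0
  else if hi : i < d then
    Matrix.toLin' (fun c b =>
      if ∀ j, j ≠ (⟨i - 1, Nat.lt_of_le_of_lt (Nat.pred_le i) hi⟩ : Fin d) →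
          j ≠ (⟨i, hi⟩ : Fin d) → c j = b j then
        Rmat q n (c ⟨i - 1, Nat.lt_of_le_of_lt (Nat.pred_le i) hi⟩, c ⟨i, hi⟩)
          (b ⟨i - 1, Nat.lt_of_le_of_lt (Nat.pred_le i) hi⟩, b ⟨i, hi⟩) else 0)
  else 0

/-- The Jucys–Murphy elements `K_i = T_{i-1} ⋯ T_1 T_0 T_1 ⋯ T_{i-1}` acting on
`V_n^{⊗ d}`, for `1 ≤ i ≤ d` (junk value `1` for `i = 0`). -/
def JM (Q q : k) (n d : ℕ) : ℕ → Module.End k ((Fin d → Fin n) → k)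
  | 0 => 1
  | 1 => TB Q q n d 0
  | i + 2 => TB Q q n d (i + 1) * JM Q q n d (i + 1) * TB Q q n d (i + 1)

/-- The element `c_K = K_1 K_2 ⋯ K_d` acting on `V_n^{⊗ d}`. -/
def cK (Q q : k) (n d : ℕ) : Module.End k ((Fin d → Fin n) → k) :=
  ((List.range d).map (fun i => JM Q q n d (i + 1))).prod

/-! ### Local operators -/

def ee {n d : ℕ} (b : Fin d → Fin n) : (Fin d → Fin n) → k := Pi.single b 1

def Kop (Q : k) (n : ℕ) {d : ℕ} (p : Fin d) : Module.End k ((Fin d → Fin n) → k) :=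
  Matrix.toLin' (fun c b => if ∀ j, j ≠ p → c j = b j then KQmat Q n (c p) (b p) else 0)

def Rop (q : k) (n : ℕ) {d : ℕ} (p r : Fin d) : Module.End k ((Fin d → Fin n) → k) :=
  Matrix.toLin' (fun c b => if ∀ j, j ≠ p → j ≠ r → c j = b j then
    Rmat q n (c p, c r) (b p, b r) else 0)

lemma TB_zero (Q q : k) (n d : ℕ) (hd : 0 < d) : TB Q q n d 0 = Kop Q n ⟨0, hd⟩ := by
  simp [TB, Kop, hd]

lemma TB_succ (Q q : k) (n d i : ℕ) (hi : i + 1 < d) :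
    TB Q q n d (i + 1) = Rop q n ⟨i, by omega⟩ ⟨i + 1, hi⟩ := by
  simp [TB, Rop, hi]

lemma TB_big (Q q : k) (n d i : ℕ) (hi : d ≤ i) : TB Q q n d i = 0 := by
  unfold TB
  split_ifs <;> first | rfl | omega

lemma val_rev (n : ℕ) (x : Fin n) : val n x.rev = - val n x := by
  simp only [val, Fin.val_rev]
  have := x.2
  omega

lemma val_inj {n : ℕ} {x y : Fin n} : val n x = val n y ↔ x = y := by
  simp only [val, Fin.ext_iff]
  omega

lemma val_lt {n : ℕ} {x y : Fin n} : val n x < val n y ↔ x < y := by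
  simp only [val, Fin.lt_def]
  omega

open Function

lemma toLin_ee {n d : ℕ} (M : (Fin d → Fin n) → (Fin d → Fin n) → k) (b c : Fin d → Fin n) :
    Matrix.toLin' (M : Matrix (Fin d → Fin n) (Fin d → Fin n) k) (ee b) c = M c b := by
  have h := Matrix.toLin'_apply (M : Matrix (Fin d → Fin n) (Fin d → Fin n) k) (ee b)
  refine (congrFun h c).trans ?_
  have h2 := Matrix.mulVec_single_one (M : Matrix (Fin d → Fin n) (Fin d → Fin n) k) b
  exact congrFun h2 c

lemma Kop_ee (Q : k) {n d : ℕ} (p : Fin d) (b : Fin d → Fin n) :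
    Kop Q n p (ee b) = if val n (b p) = 0 then Q⁻¹ • (ee b : _ → k)
      else if 0 < val n (b p) then ee (update b p (b p).rev)
      else ee (update b p (b p).rev) + (Q⁻¹ - Q) • (ee b : _ → k) := by
  have h1 : ∀ c, c = b ↔ (∀ j, j ≠ p → c j = b j) ∧ c p = b p := by
    intro c
    refine ⟨by rintro rfl; simp, fun h => funext fun j => ?_⟩
    by_cases hj : j = p
    · subst hj; exact h.2
    · exact h.1 j hj
  have h2 : ∀ c, c = update b p (b p).rev ↔ (∀ j, j ≠ p → c j = b j) ∧ c p = (b p).rev := by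
    intro c
    rw [eq_update_iff, and_comm]
  funext c
  rw [Kop, toLin_ee]
  simp only [ee]
  by_cases hc : ∀ j, j ≠ p → c j = b j
  · replace h1 := (h1 c).trans (and_iff_right hc)
    replace h2 := (h2 c).trans (and_iff_right hc)
    rw [if_pos hc]
    rcases lt_trichotomy (val n (b p)) 0 with h | h | h
    · simp [KQmat, Pi.single_apply, h1, h2, h, h.ne, h.not_gt]
    · simp [KQmat, Pi.single_apply, h1, h2, h]
    · simp [KQmat, Pi.single_apply, h1, h2, h, h.ne', h.le, h.not_gt]
  · rw [if_neg hc]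
    split_ifs <;> simp [h1, h2, hc]

lemma Rop_ee (q : k) {n d : ℕ} (p r : Fin d) (hpr : p ≠ r) (b : Fin d → Fin n) :
    Rop q n p r (ee b) = if b p = b r then q⁻¹ • (ee b : _ → k)
      else if b p < b r then ee (update (update b p (b r)) r (b p))
      else ee (update (update b p (b r)) r (b p)) + (q⁻¹ - q) • (ee b : _ → k) := by
  have h1 : ∀ c, c = b ↔ (∀ j, j ≠ p → j ≠ r → c j = b j) ∧ c p = b p ∧ c r = b r := by
    intro c
    refine ⟨by rintro rfl; simp, fun h => funext fun j => ?_⟩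
    by_cases hj : j = p
    · subst hj; exact h.2.1
    by_cases hj' : j = r
    · subst hj'; exact h.2.2
    · exact h.1 j hj hj'
  have h2 : ∀ c, c = update (update b p (b r)) r (b p) ↔
      (∀ j, j ≠ p → j ≠ r → c j = b j) ∧ c p = b r ∧ c r = b p := by
    intro c
    refine ⟨by rintro rfl; simp +contextual [hpr], fun h => funext fun j => ?_⟩
    by_cases hj' : j = r
    · subst hj'; simpa using h.2.2
    by_cases hj : j = p
    · subst hj; simpa [hj'] using h.2.1
    · simpa [hj, hj'] using h.1 j hj hj'
  funext c
  rw [Rop, toLin_ee]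
  simp only [ee]
  by_cases hc : ∀ j, j ≠ p → j ≠ r → c j = b j
  · replace h1 := (h1 c).trans (and_iff_right hc)
    replace h2 := (h2 c).trans (and_iff_right hc)
    rw [if_pos hc]
    rcases lt_trichotomy (b p) (b r) with h | h | h
    · simp [Rmat, Pi.single_apply, h1, h2, h, h.ne]
    · simp [Rmat, Pi.single_apply, h1, h2, h]
    · simp [Rmat, Pi.single_apply, h1, h2, h.ne', h.le, h.not_gt]
  · rw [if_neg hc]
    split_ifs <;> simp [h1, h2, hc]

lemma ext_ee {n d : ℕ} {A B : Module.End k ((Fin d → Fin n) → k)}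
    (h : ∀ b, A (ee b) = B (ee b)) : A = B := by
  refine (Pi.basisFun k (Fin d → Fin n)).ext fun b => ?_
  simpa [ee] using h b

lemma Kop_rules (Q : k) {n d : ℕ} (p : Fin d) (b : Fin d → Fin n) (x : Fin n) :
    (val n x = 0 → Kop Q n p (ee (update b p x)) = Q⁻¹ • (ee (update b p x) : _ → k)) ∧
    (0 < val n x → Kop Q n p (ee (update b p x)) = (ee (update b p x.rev) : _ → k)) ∧
    (val n x < 0 → Kop Q n p (ee (update b p x)) =
      ee (update b p x.rev) + (Q⁻¹ - Q) • (ee (update b p x) : _ → k)) := by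
  rw [Kop_ee]
  refine ⟨fun h => ?_, fun h => ?_, fun h => ?_⟩
  · simp [h]
  · simp [h, h.ne']
  · simp [h.ne, h.not_gt]

lemma Rop_rules (q : k) {n d : ℕ} {p r : Fin d} (hpr : p ≠ r) (b : Fin d → Fin n) (x y : Fin n) :
    (x = y → Rop q n p r (ee (update (update b p x) r y)) =
      q⁻¹ • (ee (update (update b p x) r y) : _ → k)) ∧
    (val n x < val n y → Rop q n p r (ee (update (update b p x) r y)) =
      (ee (update (update b p y) r x) : _ → k)) ∧
    (val n y < val n x → Rop q n p r (ee (update (update b p x) r y)) =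
      ee (update (update b p y) r x) + (q⁻¹ - q) • (ee (update (update b p x) r y) : _ → k)) := by
  rw [Rop_ee q p r hpr]
  have : update (update (update (update b p x) r y) p y) r x = update (update b p y) r x := by
    rw [update_comm hpr, update_idem, update_comm hpr.symm, update_idem]
  simp only [update_self, update_of_ne hpr, this, val_lt]
  refine ⟨fun h => ?_, fun h => ?_, fun h => ?_⟩
  · simp [h]
  · simp [h, h.ne]
  · simp [h.ne', h.not_gt]

lemma Kop_sq (Q : k) (hQ : Q ≠ 0) {n d : ℕ} (p : Fin d) :
    Kop Q n p * Kop Q n p = (Q⁻¹ - Q) • Kop Q n p + 1 := by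
  refine ext_ee fun b => ?_
  obtain ⟨b, x, rfl⟩ : ∃ b' x, b = update b' p x := ⟨b, b p, by simp⟩
  have R1 := fun x => (Kop_rules Q p b x).1
  have R2 := fun x => (Kop_rules Q p b x).2.1
  have R3 := fun x => (Kop_rules Q p b x).2.2
  have hr := val_rev n x
  simp only [Module.End.mul_apply, LinearMap.add_apply, LinearMap.smul_apply, Module.End.one_apply]
  rcases lt_trichotomy (val n x) 0 with h | h | h
  · simp (disch := omega) only [R3, R2, map_add, map_smul, Fin.rev_rev]
    module
  · simp (disch := omega) only [R1, map_smul]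
    match_scalars
    field_simp
    ring
  · simp (disch := omega) only [R3, R2, Fin.rev_rev]
    module

lemma Rop_sq (q : k) (hq : q ≠ 0) {n d : ℕ} {p r : Fin d} (hpr : p ≠ r) :
    Rop q n p r * Rop q n p r = (q⁻¹ - q) • Rop q n p r + 1 := by
  refine ext_ee fun b => ?_
  obtain ⟨b, x, y, rfl⟩ : ∃ b' x y, b = update (update b' p x) r y := ⟨b, b p, b r, by simp⟩
  have R1 := fun x => (Rop_rules q hpr b x x).1 rfl
  have R2 := fun x y => (Rop_rules q hpr b x y).2.1
  have R3 := fun x y => (Rop_rules q hpr b x y).2.2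
  simp only [Module.End.mul_apply, LinearMap.add_apply, LinearMap.smul_apply, Module.End.one_apply]
  rcases lt_trichotomy (val n x) (val n y) with h | h | h
  · simp (disch := omega) only [R3, R2]
    module
  · rw [val_inj] at h
    subst h
    simp only [R1, map_smul]
    match_scalars
    field_simp
    ring
  · simp (disch := omega) only [R3, R2, map_add, map_smul]
    module

lemma braid_abs {M : Type*} [AddCommGroup M] [Module k M] (q : k) (hq : q ≠ 0) {n : ℕ}
    (A B : Module.End k M) (F : Fin n → Fin n → Fin n → M)
    (A1 : ∀ x z, A (F x x z) = q⁻¹ • F x x z)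
    (A2 : ∀ x y z, val n x < val n y → A (F x y z) = F y x z)
    (A3 : ∀ x y z, val n y < val n x → A (F x y z) = F y x z + (q⁻¹ - q) • F x y z)
    (B1 : ∀ x z, B (F x z z) = q⁻¹ • F x z z)
    (B2 : ∀ x y z, val n y < val n z → B (F x y z) = F x z y)
    (B3 : ∀ x y z, val n z < val n y → B (F x y z) = F x z y + (q⁻¹ - q) • F x y z)
    (x y z : Fin n) : A (B (A (F x y z))) = B (A (B (F x y z))) := by
  rcases lt_trichotomy (val n x) (val n y) with h | h | h <;>
  rcases lt_trichotomy (val n y) (val n z) with h' | h' | h' <;>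
  rcases lt_trichotomy (val n x) (val n z) with h'' | h'' | h'' <;>
  first
  | (exfalso; omega)
  | (try rw [val_inj] at h
     try rw [val_inj] at h'
     try rw [val_inj] at h''
     try subst h
     try subst h'
     try subst h''
     simp (disch := omega) only [A1, A2, A3, B1, B2, B3, map_add, map_smul]
     try (match_scalars <;> field_simp <;> ring))

lemma typeB_abs {M : Type*} [AddCommGroup M] [Module k M] (Q q : k) (hQ : Q ≠ 0) (hq : q ≠ 0)
    {n : ℕ} (A B : Module.End k M) (F : Fin n → Fin n → M)
    (A1 : ∀ x z, val n x = 0 → A (F x z) = Q⁻¹ • F x z)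
    (A2 : ∀ x y, 0 < val n x → A (F x y) = F x.rev y)
    (A3 : ∀ x y, val n x < 0 → A (F x y) = F x.rev y + (Q⁻¹ - Q) • F x y)
    (B1 : ∀ x, B (F x x) = q⁻¹ • F x x)
    (B2 : ∀ x y, val n x < val n y → B (F x y) = F y x)
    (B3 : ∀ x y, val n y < val n x → B (F x y) = F y x + (q⁻¹ - q) • F x y)
    (x y : Fin n) : A (B (A (B (F x y)))) = B (A (B (A (F x y)))) := by
  have hx := val_rev n x
  have hy := val_rev n y
  have key : ∀ u v : Fin n, val n u = - val n v → u = v.rev := by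
    intro u v h
    rw [← val_inj, h, val_rev]
  rcases lt_trichotomy (val n x) 0 with h | h | h <;>
  rcases lt_trichotomy (val n y) 0 with h' | h' | h' <;>
  rcases lt_trichotomy (val n x) (val n y) with h1 | h1 | h1 <;>
  rcases lt_trichotomy (val n x) (- val n y) with h2 | h2 | h2 <;>
  first
  | (exfalso; omega)
  | (try (rw [val_inj] at h1; subst h1)
     try (have h2 := key _ _ h2; subst h2)
     simp (disch := omega) only [A1, A2, A3, B1, B2, B3, map_add, map_smul, Fin.rev_rev]
     try (match_scalars <;> field_simp <;> ring))

lemma braid_R (q : k) (hq : q ≠ 0) {n d : ℕ} {p r s : Fin d} (hpr : p ≠ r) (hrs : r ≠ s)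
    (hps : p ≠ s) :
    Rop q n p r * Rop q n r s * Rop q n p r = Rop q n r s * Rop q n p r * Rop q n r s := by
  refine ext_ee fun b => ?_
  have e1 : ∀ x y z, update (update (update b p x) r y) s z =
      update (update (update b s z) p x) r y := fun x y z => by
    rw [update_comm hrs, update_comm hps]
  have H := braid_abs q hq (Rop q n p r) (Rop q n r s)
    (fun x y z => (ee (update (update (update b p x) r y) s z) : _ → k))
    (fun x z => by simpa only [e1] using (Rop_rules q hpr (update b s z) x x).1 rfl)
    (fun x y z => by simpa only [e1] using (Rop_rules q hpr (update b s z) x y).2.1)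
    (fun x y z => by simpa only [e1] using (Rop_rules q hpr (update b s z) x y).2.2)
    (fun x z => (Rop_rules q hrs (update b p x) z z).1 rfl)
    (fun x y z => (Rop_rules q hrs (update b p x) y z).2.1)
    (fun x y z => (Rop_rules q hrs (update b p x) y z).2.2) (b p) (b r) (b s)
  simpa using H

lemma typeB_KR (Q q : k) (hQ : Q ≠ 0) (hq : q ≠ 0) {n d : ℕ} {p r : Fin d} (hpr : p ≠ r) :
    Kop Q n p * Rop q n p r * Kop Q n p * Rop q n p r =
      Rop q n p r * Kop Q n p * Rop q n p r * Kop Q n p := by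
  refine ext_ee fun b => ?_
  have e1 : ∀ x y, update (update b p x) r y =
      update (update b r y) p x := fun x y => by
    rw [update_comm hpr]
  have H := typeB_abs Q q hQ hq (Kop Q n p) (Rop q n p r)
    (fun x y => (ee (update (update b p x) r y) : _ → k))
    (fun x z => by simpa only [e1] using (Kop_rules Q p (update b r z) x).1)
    (fun x z => by simpa only [e1] using (Kop_rules Q p (update b r z) x).2.1)
    (fun x z => by simpa only [e1] using (Kop_rules Q p (update b r z) x).2.2)
    (fun x => (Rop_rules q hpr b x x).1 rfl)
    (fun x y => (Rop_rules q hpr b x y).2.1)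
    (fun x y => (Rop_rules q hpr b x y).2.2) (b p) (b r)
  simpa using H

lemma comm_KR (Q q : k) {n d : ℕ} {p r s : Fin d} (hpr : p ≠ r) (hrs : r ≠ s)
    (hps : p ≠ s) : Commute (Kop Q n p) (Rop q n r s) := by
  refine ext_ee fun b => ?_
  have e1 : ∀ x y z, update (update (update b p x) r y) s z =
      update (update (update b r y) s z) p x := fun x y z => by
    rw [update_comm hpr, update_comm hps]
  have A1 := fun x y z => (Kop_rules Q p (update (update b r y) s z) x).1
  have A2 := fun x y z => (Kop_rules Q p (update (update b r y) s z) x).2.1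
  have A3 := fun x y z => (Kop_rules Q p (update (update b r y) s z) x).2.2
  have B1 := fun x z => (Rop_rules q hrs (update b p x) z z).1 rfl
  have B2 := fun x y z => (Rop_rules q hrs (update b p x) y z).2.1
  have B3 := fun x y z => (Rop_rules q hrs (update b p x) y z).2.2
  simp only [← e1] at A1 A2 A3
  have H : ∀ x y z, Kop Q n p (Rop q n r s (ee (update (update (update b p x) r y) s z))) =
      Rop q n r s (Kop Q n p (ee (update (update (update b p x) r y) s z))) := by
    intro x y z
    rcases lt_trichotomy (val n x) 0 with h | h | h <;>
    rcases lt_trichotomy (val n y) (val n z) with h' | h' | h' <;>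
    (try (rw [val_inj] at h'; subst h')) <;>
    simp (disch := omega) only [A1, A2, A3, B1, B2, B3, map_add, map_smul] <;>
    module
  simpa using H (b p) (b r) (b s)

lemma comm_RR (q : k) {n d : ℕ} {p t r s : Fin d} (hpt : p ≠ t) (hpr : p ≠ r) (hrs : r ≠ s)
    (hps : p ≠ s) (htr : t ≠ r) (hts : t ≠ s) : Commute (Rop q n p t) (Rop q n r s) := by
  refine ext_ee fun b => ?_
  have e1 : ∀ x w y z, update (update (update (update b p x) t w) r y) s z =
      update (update (update (update b r y) s z) p x) t w := fun x w y z => by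
    rw [update_comm htr, update_comm hts, update_comm hpr, update_comm hps]
  have A1 := fun x y z => (Rop_rules q hpt (update (update b r y) s z) x x).1 rfl
  have A2 := fun x w y z => (Rop_rules q hpt (update (update b r y) s z) x w).2.1
  have A3 := fun x w y z => (Rop_rules q hpt (update (update b r y) s z) x w).2.2
  have B1 := fun x w z => (Rop_rules q hrs (update (update b p x) t w) z z).1 rfl
  have B2 := fun x w y z => (Rop_rules q hrs (update (update b p x) t w) y z).2.1
  have B3 := fun x w y z => (Rop_rules q hrs (update (update b p x) t w) y z).2.2
  simp only [← e1] at A1 A2 A3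
  have H : ∀ x w y z, Rop q n p t (Rop q n r s
      (ee (update (update (update (update b p x) t w) r y) s z))) =
      Rop q n r s (Rop q n p t (ee (update (update (update (update b p x) t w) r y) s z))) := by
    intro x w y z
    rcases lt_trichotomy (val n x) (val n w) with h | h | h <;>
    rcases lt_trichotomy (val n y) (val n z) with h' | h' | h' <;>
    (try (rw [val_inj] at h; subst h)) <;>
    (try (rw [val_inj] at h'; subst h')) <;>
    simp (disch := omega) only [A1, A2, A3, B1, B2, B3, map_add, map_smul] <;>
    module
  simpa using H (b p) (b t) (b r) (b s)

/-! ### Relations for `TB` -/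

lemma TB_sq (Q q : k) (hq : q ≠ 0) (n d i : ℕ) (hi : i + 1 < d) :
    TB Q q n d (i + 1) * TB Q q n d (i + 1) = (q⁻¹ - q) • TB Q q n d (i + 1) + 1 := by
  rw [TB_succ _ _ _ _ _ hi]
  exact Rop_sq q hq (by simp)

lemma TB_comm (Q q : k) (n d i j : ℕ) (h : i + 2 ≤ j) :
    Commute (TB Q q n d i) (TB Q q n d j) := by
  by_cases hj : d ≤ j
  · rw [TB_big _ _ _ _ _ hj]; exact Commute.zero_right _
  obtain ⟨j, rfl⟩ : ∃ m, j = m + 1 := ⟨j - 1, by omega⟩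
  rw [TB_succ _ _ _ _ j (by omega)]
  cases i with
  | zero =>
    rw [TB_zero _ _ _ _ (by omega)]
    apply comm_KR <;> simp [Fin.ext_iff] <;> omega
  | succ i =>
    rw [TB_succ _ _ _ _ i (by omega)]
    apply comm_RR <;> simp [Fin.ext_iff] <;> omega

lemma TB_braid (Q q : k) (hq : q ≠ 0) (n d i : ℕ) :
    TB Q q n d (i + 1) * TB Q q n d (i + 2) * TB Q q n d (i + 1) =
    TB Q q n d (i + 2) * TB Q q n d (i + 1) * TB Q q n d (i + 2) := by
  by_cases hj : d ≤ i + 2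
  · simp [TB_big _ _ _ _ _ hj]
  rw [TB_succ _ _ _ _ i (by omega), TB_succ _ _ _ _ (i + 1) (by omega)]
  apply braid_R q hq <;> simp only [ne_eq, Fin.ext_iff] <;> omega

lemma TB_four (Q q : k) (hQ : Q ≠ 0) (hq : q ≠ 0) (n d : ℕ) :
    TB Q q n d 0 * TB Q q n d 1 * TB Q q n d 0 * TB Q q n d 1 =
    TB Q q n d 1 * TB Q q n d 0 * TB Q q n d 1 * TB Q q n d 0 := by
  by_cases hj : d ≤ 1
  · simp [TB_big _ _ _ _ _ hj]
  rw [TB_zero _ _ _ _ (by omega), TB_succ _ _ _ _ 0 (by omega)]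
  apply typeB_KR Q q hQ hq
  simp [Fin.ext_iff]

lemma JM_comm_far (Q q : k) (n d : ℕ) : ∀ i j, i + 1 ≤ j →
    Commute (JM Q q n d i) (TB Q q n d j)
  | 0, j, _ => Commute.one_left _
  | 1, j, h => TB_comm _ _ _ _ _ _ (by omega)
  | i + 2, j, h => by
    have h1 := TB_comm Q q n d (i + 1) j (by omega)
    have h2 := JM_comm_far Q q n d (i + 1) j (by omega)
    exact (h1.mul_left h2).mul_left h1

lemma TB_comm_JM (Q q : k) (hQ : Q ≠ 0) (hq : q ≠ 0) (n d : ℕ) : ∀ i m, m + 2 ≤ i →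
    Commute (TB Q q n d m) (JM Q q n d i)
  | 0, m, h => by omega
  | 1, m, h => by omega
  | i + 2, m, h => by
    rcases Nat.lt_or_ge m i with hm | hm
    · have h1 := TB_comm Q q n d m (i + 1) (by omega)
      have h2 := TB_comm_JM Q q hQ hq n d (i + 1) m (by omega)
      exact (h1.mul_right h2).mul_right h1
    obtain rfl : m = i := by omega
    cases m with
    | zero =>
      have := TB_four Q q hQ hq n d
      simp only [Commute, SemiconjBy, JM, zero_add]
      simpa only [mul_assoc] using this
    | succ m =>
      have hb := TB_braid Q q hq n d m
      have hc : Commute (JM Q q n d (m + 1)) (TB Q q n d (m + 2)) :=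
        JM_comm_far Q q n d (m + 1) (m + 2) (by omega)
      simp only [Commute, SemiconjBy, JM]
      change TB Q q n d (m + 1) * (TB Q q n d (m + 2) * (TB Q q n d (m + 1) * JM Q q n d (m + 1) *
        TB Q q n d (m + 1)) * TB Q q n d (m + 2)) = (TB Q q n d (m + 2) * (TB Q q n d (m + 1) *
        JM Q q n d (m + 1) * TB Q q n d (m + 1)) * TB Q q n d (m + 2)) * TB Q q n d (m + 1)
      generalize TB Q q n d (m + 1) = s at *
      generalize TB Q q n d (m + 2) = t at *
      generalize JM Q q n d (m + 1) = x at *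
      calc s * (t * (s * x * s) * t) = (s * t * s) * x * s * t := by simp only [mul_assoc]
        _ = t * s * (t * x) * s * t := by rw [hb]; simp only [mul_assoc]
        _ = t * s * x * (t * s * t) := by rw [← hc.eq]; simp only [mul_assoc]
        _ = t * (s * x * s) * t * s := by rw [← hb]; simp only [mul_assoc]

lemma JM_comm_lt (Q q : k) (hQ : Q ≠ 0) (hq : q ≠ 0) (n d : ℕ) (j : ℕ) : ∀ i, i < j →
    Commute (JM Q q n d i) (JM Q q n d j)
  | 0, _ => Commute.one_left _
  | 1, h => TB_comm_JM Q q hQ hq n d j 0 (by omega)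
  | i + 2, h => by
    have h1 := TB_comm_JM Q q hQ hq n d j (i + 1) (by omega)
    have h2 := JM_comm_lt Q q hQ hq n d j (i + 1) (by omega)
    exact (h1.mul_left h2).mul_left h1

lemma JM_comm (Q q : k) (hQ : Q ≠ 0) (hq : q ≠ 0) (n d i j : ℕ) :
    Commute (JM Q q n d i) (JM Q q n d j) := by
  rcases lt_trichotomy i j with h | rfl | h
  · exact JM_comm_lt Q q hQ hq n d j i h
  · exact Commute.refl _
  · exact (JM_comm_lt Q q hQ hq n d i j h).symm

/-! ### Eigenvalues -/

def Good (Q q x : k) : Prop := ∃ a b : ℤ, x = Q ^ a * q ^ b ∨ x = -(Q ^ a * q ^ b)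

lemma Good.mul {Q q x y : k} (hQ : Q ≠ 0) (hq : q ≠ 0) (hx : Good Q q x) (hy : Good Q q y) :
    Good Q q (x * y) := by
  obtain ⟨a, b, h⟩ := hx
  obtain ⟨a', b', h'⟩ := hy
  refine ⟨a + a', b + b', ?_⟩
  rw [zpow_add₀ hQ, zpow_add₀ hq]
  rcases h with rfl | rfl <;> rcases h' with rfl | rfl
  · left; ring
  · right; ring
  · right; ring
  · left; ring

lemma quad_root {c e : k} (hc : c ≠ 0) (h : e * e = (c⁻¹ - c) * e + 1) : e = c⁻¹ ∨ e = -c := by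
  have : (e - c⁻¹) * (e + c) = 0 := by
    have hc' : c⁻¹ * c = 1 := inv_mul_cancel₀ hc
    linear_combination h - hc'
  rcases mul_eq_zero.1 this with h | h
  · left; exact sub_eq_zero.1 h
  · right; exact eq_neg_of_add_eq_zero_left h

lemma joint {V : Type*} [AddCommGroup V] [Module k V] [FiniteDimensional k V] [IsAlgClosed k] :
    ∀ (l : List (Module.End k V)) (W : Submodule k V), W ≠ ⊥ →
    (∀ A ∈ l, ∀ B ∈ l, Commute A B) → (∀ A ∈ l, ∀ w ∈ W, A w ∈ W) →
    ∃ v ∈ W, v ≠ 0 ∧ ∀ A ∈ l, ∃ c : k, A v = c • v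
  | [], W, hW, _, _ => by
    obtain ⟨v, hv, h0⟩ := Submodule.exists_mem_ne_zero_of_ne_bot hW
    exact ⟨v, hv, h0, by simp⟩
  | A :: l, W, hW, hc, hi => by
    have : Nontrivial W := Submodule.nontrivial_iff_ne_bot.2 hW
    have hA : ∀ w ∈ W, A w ∈ W := hi A (by simp)
    obtain ⟨c, hcE⟩ := Module.End.exists_eigenvalue (A.restrict hA)
    obtain ⟨w, hw⟩ := hcE.exists_hasEigenvector
    have hw1 : A w = c • (w : V) := by
      have := congrArg Subtype.val hw.apply_eq_smul
      simpa using this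
    obtain ⟨v, hv, h0, hl⟩ := joint l (W ⊓ Module.End.eigenspace A c)
      (by
        intro hbot
        have hm : (w : V) ∈ W ⊓ Module.End.eigenspace A c :=
          ⟨w.2, Module.End.mem_eigenspace_iff.2 hw1⟩
        rw [hbot, Submodule.mem_bot] at hm
        exact hw.2 (Subtype.ext hm))
      (fun A hA B hB => hc A (by simp [hA]) B (by simp [hB]))
      (fun B hB x hx => by
        refine ⟨hi B (by simp [hB]) x hx.1, ?_⟩
        have hx2 := Module.End.mem_eigenspace_iff.1 hx.2
        have hAB := LinearMap.congr_fun (hc A (by simp) B (by simp [hB])).eq x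
        simp only [Module.End.mul_apply] at hAB
        exact Module.End.mem_eigenspace_iff.2 (by rw [hAB, hx2, map_smul]))
    refine ⟨v, hv.1, h0, ?_⟩
    intro B hB
    rcases List.mem_cons.1 hB with rfl | hB
    · exact ⟨c, Module.End.mem_eigenspace_iff.1 hv.2⟩
    · exact hl B hB

lemma eig_step {V : Type*} [AddCommGroup V] [Module k V] [FiniteDimensional k V] [IsAlgClosed k]
    (Q q : k) (hQ : Q ≠ 0) (hq : q ≠ 0) (T A : Module.End k V)
    (hT : T * T = (q⁻¹ - q) • T + 1) (hAB : Commute A (T * A * T))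
    (hA : ∀ (a : k) (v : V), v ≠ 0 → A v = a • v → Good Q q a)
    (b : k) (v : V) (hv : v ≠ 0) (hB : (T * A * T) v = b • v) : Good Q q b := by
  obtain ⟨v, hvW, hv, hvA⟩ := joint [A] (Module.End.eigenspace (T * A * T) b)
    (by
      intro hbot
      have hm : v ∈ Module.End.eigenspace (T * A * T) b := Module.End.mem_eigenspace_iff.2 hB
      rw [hbot, Submodule.mem_bot] at hm
      exact hv hm)
    (by simp)
    (by
      intro A' hA' x hx
      rw [List.mem_singleton.1 hA']
      have hx2 := Module.End.mem_eigenspace_iff.1 hx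
      have h : A ((T * A * T) x) = (T * A * T) (A x) := LinearMap.congr_fun hAB.eq x
      exact Module.End.mem_eigenspace_iff.2 (by rw [← h, hx2, map_smul]))
  replace hB := Module.End.mem_eigenspace_iff.1 hvW
  obtain ⟨a, ha⟩ := hvA A (by simp)
  have hT' : ∀ x, T (T x) = (q⁻¹ - q) • T x + x := fun x => by
    have := LinearMap.congr_fun hT x
    simpa using this
  have hB' : T (A (T v)) = b • v := by simpa using hB
  by_cases he : ∃ e : k, T v = e • v
  · obtain ⟨e, he⟩ := he
    have h1 := hT' v
    simp only [he, map_smul, smul_smul] at h1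
    have h2 : e * e = (q⁻¹ - q) * e + 1 :=
      smul_left_injective k hv (by simpa [add_smul] using h1)
    have h3 : b = (e * e) * a := by
      simp only [he, ha, map_smul, smul_smul] at hB'
      have := smul_left_injective k hv hB'
      rw [← this]; ring
    rw [h3]
    refine Good.mul hQ hq ?_ (hA a v hv ha)
    rcases quad_root hq h2 with rfl | rfl
    · exact ⟨0, -2, Or.inl (by rw [zpow_zero, zpow_neg, zpow_ofNat, one_mul, pow_two, mul_inv])⟩
    · exact ⟨0, 2, Or.inl (by simp [pow_two, zpow_ofNat])⟩
  · by_cases hab : a = b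
    · rw [← hab]; exact hA a v hv ha
    have hab' : a - b ≠ 0 := sub_ne_zero.2 hab
    have hATv : A (T v) = b • T v - (b * (q⁻¹ - q)) • v := by
      have h1 := hT' (A (T v))
      rw [hB', map_smul] at h1
      rw [← sub_eq_iff_eq_add'] at h1
      rw [← h1]
      module
    refine hA b (T v + (b * (q⁻¹ - q) / (a - b)) • v) ?_ ?_
    · intro h
      exact he ⟨-(b * (q⁻¹ - q) / (a - b)), by rw [neg_smul]; exact eq_neg_of_add_eq_zero_left h⟩
    · rw [map_add, map_smul, hATv, ha]
      match_scalars
      · ring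
      · field_simp
        ring

lemma JM_eig [IsAlgClosed k] (Q q : k) (hQ : Q ≠ 0) (hq : q ≠ 0) (n d : ℕ) : ∀ i, i < d →
    ∀ (a : k) (v : (Fin d → Fin n) → k), v ≠ 0 → JM Q q n d (i + 1) v = a • v → Good Q q a
  | 0, hd, a, v, hv, h => by
    simp only [zero_add, JM, TB_zero _ _ _ _ hd] at h
    have h1 := LinearMap.congr_fun (Kop_sq Q hQ (n := n) (⟨0, hd⟩ : Fin d)) v
    simp only [Module.End.mul_apply, LinearMap.add_apply, LinearMap.smul_apply,
      Module.End.one_apply, h, map_smul, smul_smul] at h1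
    have h2 : a * a = (Q⁻¹ - Q) * a + 1 :=
      smul_left_injective k hv (by simpa [add_smul] using h1)
    rcases quad_root hQ h2 with rfl | rfl
    · exact ⟨-1, 0, Or.inl (by simp)⟩
    · exact ⟨1, 0, Or.inr (by simp)⟩
  | i + 1, hd, a, v, hv, h =>
    eig_step Q q hQ hq (TB Q q n d (i + 1)) (JM Q q n d (i + 1)) (TB_sq Q q hq n d i hd)
      (JM_comm Q q hQ hq n d (i + 1) (i + 2)) (JM_eig Q q hQ hq n d i (by omega)) a v hv h

lemma prod_good {V : Type*} [AddCommGroup V] [Module k V] (Q q : k) (hQ : Q ≠ 0) (hq : q ≠ 0)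
    (v : V) : ∀ l : List (Module.End k V), (∀ A ∈ l, ∃ c : k, Good Q q c ∧ A v = c • v) →
    ∃ c : k, Good Q q c ∧ l.prod v = c • v
  | [], _ => ⟨1, ⟨0, 0, by simp⟩, by simp⟩
  | A :: l, h => by
    obtain ⟨c, hc, hv⟩ := prod_good Q q hQ hq v l (fun B hB => h B (by simp [hB]))
    obtain ⟨c', hc', hv'⟩ := h A (by simp)
    refine ⟨c * c', hc.mul hQ hq hc', ?_⟩
    rw [List.prod_cons, Module.End.mul_apply, hv, map_smul, hv', smul_smul]

lemma cK_eig [IsAlgClosed k] (Q q : k) (hQ : Q ≠ 0) (hq : q ≠ 0) (n d : ℕ)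
    (a : k) (v : (Fin d → Fin n) → k) (hv : v ≠ 0) (h : cK Q q n d v = a • v) : Good Q q a := by
  have hcomm : ∀ A ∈ (List.range d).map (fun i => JM Q q n d (i + 1)),
      ∀ B ∈ (List.range d).map (fun i => JM Q q n d (i + 1)), Commute A B := by
    intro A hA B hB
    obtain ⟨i, -, rfl⟩ := List.mem_map.1 hA
    obtain ⟨j, -, rfl⟩ := List.mem_map.1 hB
    exact JM_comm Q q hQ hq n d _ _
  obtain ⟨w, hwW, hw, hwA⟩ := joint ((List.range d).map (fun i => JM Q q n d (i + 1)))
    (Module.End.eigenspace (cK Q q n d) a)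
    (by
      intro hbot
      have hm : v ∈ Module.End.eigenspace (cK Q q n d) a := Module.End.mem_eigenspace_iff.2 h
      rw [hbot, Submodule.mem_bot] at hm
      exact hv hm)
    hcomm
    (by
      intro A hA x hx
      have hx2 := Module.End.mem_eigenspace_iff.1 hx
      have hc : Commute A (cK Q q n d) := Commute.list_prod_right _ _ (fun B hB => hcomm A hA B hB)
      have h := LinearMap.congr_fun hc.eq x
      rw [Module.End.mul_apply, Module.End.mul_apply] at h
      exact Module.End.mem_eigenspace_iff.2 (by rw [← h, hx2, map_smul]))
  obtain ⟨c, hc, hcw⟩ := prod_good Q q hQ hq w ((List.range d).map (fun i => JM Q q n d (i + 1)))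
    (by
      intro A hA
      obtain ⟨c, hc⟩ := hwA A hA
      obtain ⟨i, hi, rfl⟩ := List.mem_map.1 hA
      exact ⟨c, JM_eig Q q hQ hq n d i (List.mem_range.1 hi) c w hw hc, hc⟩)
  have h1 : cK Q q n d w = a • w := Module.End.mem_eigenspace_iff.1 hwW
  have h2 : cK Q q n d w = c • w := hcw
  have : a = c := smul_left_injective k hw (h1.symm.trans h2)
  rw [this]; exact hc

/-! ### Base change -/

section BaseChange

variable {L : Type*} [Field L] (f : k →+* L)

lemma toLin_map {ι : Type*} [Fintype ι] [DecidableEq ι] (M : Matrix ι ι k) (M' : Matrix ι ι L)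
    (h : ∀ c b, M' c b = f (M c b)) (v : ι → k) :
    Matrix.toLin' M' (fun b => f (v b)) = fun c => f (Matrix.toLin' M v c) := by
  funext c
  simp [Matrix.toLin'_apply, Matrix.mulVec, dotProduct, h]

lemma TB_map (Q q : k) (n d i : ℕ) (v : (Fin d → Fin n) → k) :
    TB (f Q) (f q) n d i (fun b => f (v b)) = fun c => f (TB Q q n d i v c) := by
  unfold TB
  split_ifs with h0 hd hi
  · apply toLin_map
    intro c b
    dsimp only [KQmat]
    split_ifs <;> simp
  · funext c; simp
  · apply toLin_map
    intro c b
    dsimp only [Rmat]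
    split_ifs <;> simp
  · funext c; simp

lemma JM_map (Q q : k) (n d : ℕ) : ∀ (i : ℕ) (v : (Fin d → Fin n) → k),
    JM (f Q) (f q) n d i (fun b => f (v b)) = fun c => f (JM Q q n d i v c)
  | 0, v => rfl
  | 1, v => TB_map f Q q n d 0 v
  | i + 2, v => by
    simp only [JM, Module.End.mul_apply]
    rw [TB_map, JM_map Q q n d (i + 1), TB_map]

lemma list_map (Q q : k) (n d : ℕ) (v : (Fin d → Fin n) → k) : ∀ l : List ℕ,
    (l.map (fun i => JM (f Q) (f q) n d (i + 1))).prod (fun b => f (v b)) =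
      fun c => f ((l.map (fun i => JM Q q n d (i + 1))).prod v c)
  | [] => rfl
  | i :: l => by
    simp only [List.map_cons, List.prod_cons, Module.End.mul_apply]
    rw [list_map Q q n d v l, JM_map]

end BaseChange

/-- Every eigenvalue of `c_K = K_1 K_2 ⋯ K_d` on `V_n^{⊗d}` is of
the form `Q^a q^b` or `-Q^a q^b` for some integers `a, b`. -/
theorem eigenvalues_cK
    (Q q : k) (hQ : Q ≠ 0) (hq : q ≠ 0) (n d : ℕ) (hn : 1 ≤ n) (hd : 1 ≤ d)
    (μ : k) (hμ : Module.End.HasEigenvalue (cK Q q n d) μ) :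
    ∃ a b : ℤ, μ = Q ^ a * q ^ b ∨ μ = -(Q ^ a * q ^ b) := by
  obtain ⟨v, hv⟩ := hμ.exists_hasEigenvector
  let f := algebraMap k (AlgebraicClosure k)
  have hf : Function.Injective f := f.injective
  have h1 := list_map f Q q n d v (List.range d)
  have h2 : cK (f Q) (f q) n d (fun b => f (v b)) = f μ • (fun b => f (v b)) := by
    have h3 : cK Q q n d v = μ • v := hv.apply_eq_smul
    refine h1.trans ?_
    funext c
    change f (cK Q q n d v c) = _
    simp [h3]
  obtain ⟨a, b, h⟩ := cK_eig (f Q) (f q) (by simpa using hQ) (by simpa using hq) n d (f μ) _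
    (fun h0 => hv.2 (funext fun c => hf (by simpa using congrFun h0 c))) h2
  refine ⟨a, b, ?_⟩
  rcases h with h | h
  · left; apply hf; simpa using h
  · right; apply hf; simpa using h

end QSP
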